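/- Let a be the monomial ideal of R with exponent set A and let J be the monomial ideal of R with exponent set B, where A, B are finite nonempty subsets of σ^∨ ∩ ℤ^d and a ⊆ √J. Then the F-threshold c^J(a), i.e. the limit of ν_a^J(p^e)/p^e as e → ∞, equals sup_{u ∈ σ^∨ \ Q(B)} λ_A(u). -/

import Mathlib

open Finset Filter Pointwise

noncomputable section

namespace Paper

variable {d n : ℕ}

/-- The standard inner product pairing on `ℝ^d`. -/
def pair (u w : Fin d → ℝ) : ℝ := ∑ i, u i * w i

/-- The coercion `ℤ^d → ℝ^d`. -/
def toR (u : Fin d → ℤ) : Fin d → ℝ := fun i => (u i : ℝ)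

/-- The cone generated by the integer vectors `v 1, …, v n`. -/
def cone (v : Fin n → Fin d → ℤ) : Set (Fin d → ℝ) :=
  {x | ∃ c : Fin n → ℝ, (∀ j, 0 ≤ c j) ∧ x = ∑ j, c j • toR (v j)}

/-- The dual cone `σ^∨ = {u | ⟨u, x⟩ ≥ 0 for all x ∈ σ}`. -/
def dualCone (v : Fin n → Fin d → ℤ) : Set (Fin d → ℝ) :=
  {u | ∀ x ∈ cone v, 0 ≤ pair u x}

/-- Strong convexity of the cone generated by `v`. -/
def StronglyConvex (v : Fin n → Fin d → ℤ) : Prop :=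
  ∀ x ∈ cone v, -x ∈ cone v → x = 0

/-- An integer vector is primitive if the gcd of its coordinates is 1. -/
def IsPrimitive (w : Fin d → ℤ) : Prop := Finset.univ.gcd w = 1

/-- The cone generated by `v` is `d`-dimensional. -/
def FullDim (v : Fin n → Fin d → ℤ) : Prop :=
  Submodule.span ℝ (Set.range fun j => toR (v j)) = ⊤

/-- The Newton polyhedron `P(A) = conv(A) + σ^∨`. -/
def newton (v : Fin n → Fin d → ℤ) (A : Finset (Fin d → ℤ)) : Set (Fin d → ℝ) :=
  convexHull ℝ (toR '' ↑A) + dualCone v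

/-- The set `Q(A) = ⋃_{a ∈ A} (a + σ^∨)`. -/
def QSet (v : Fin n → Fin d → ℤ) (A : Finset (Fin d → ℤ)) : Set (Fin d → ℝ) :=
  ⋃ a ∈ A, (toR a +ᵥ dualCone v)

/-- `λ_A(u) = sup {λ > 0 | u ∈ λ·P(A)}` (and `0` if no such `λ` exists;
note `Real.sSup` of the empty set is `0`). -/
def lam (v : Fin n → Fin d → ℤ) (A : Finset (Fin d → ℤ)) (u : Fin d → ℝ) : ℝ :=
  sSup {l : ℝ | 0 < l ∧ u ∈ l • newton v A}

/-- `Q(m)` for the maximal monomial ideal, whose exponent set is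
`(σ^∨ ∩ ℤ^d) \ {0}`. -/
def Qm (v : Fin n → Fin d → ℤ) : Set (Fin d → ℝ) :=
  ⋃ a ∈ {a : Fin d → ℤ | toR a ∈ dualCone v ∧ a ≠ 0}, (toR a +ᵥ dualCone v)

/-- The set `O = {u ∈ σ^∨ | ⟨u, v_j⟩ ≥ 1 for some j}`. -/
def OSet (v : Fin n → Fin d → ℤ) : Set (Fin d → ℝ) :=
  {u ∈ dualCone v | ∃ j, 1 ≤ pair u (toR (v j))}

/-- The additive submonoid `σ^∨ ∩ ℤ^d` of `ℤ^d`. -/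
def latt (v : Fin n → Fin d → ℤ) : AddSubmonoid (Fin d → ℤ) where
  carrier := {u | toR u ∈ dualCone v}
  zero_mem' := by
    intro x hx
    simp [pair, toR]
  add_mem' := by
    intro a b ha hb x hx
    have h : pair (toR (a + b)) x = pair (toR a) x + pair (toR b) x := by
      simp [pair, toR, add_mul, Finset.sum_add_distrib]
    have h2 := add_nonneg (ha x hx) (hb x hx)
    rw [h]
    exact h2

/-- The toric ring `R = k[σ^∨ ∩ ℤ^d]`, as the monoid algebra of the
additive monoid `σ^∨ ∩ ℤ^d` over `k`. -/
abbrev Toric (k : Type) [Field k] (v : Fin n → Fin d → ℤ) : Type :=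
  AddMonoidAlgebra k (latt v)

/-- The monomial ideal of `R` with exponent set `A`: the ideal generated by
the monomials `X^a`, `a ∈ A`. -/
def monIdeal (k : Type) [Field k] (v : Fin n → Fin d → ℤ) (A : Finset (Fin d → ℤ)) :
    Ideal (Toric k v) :=
  Ideal.span {x | ∃ a : latt v, (a : Fin d → ℤ) ∈ A ∧ x = AddMonoidAlgebra.single a 1}

/-- The maximal monomial ideal of `R`, generated by all monomials `X^u`
with `u ∈ (σ^∨ ∩ ℤ^d) \ {0}`. -/
def maxMonIdeal (k : Type) [Field k] (v : Fin n → Fin d → ℤ) : Ideal (Toric k v) :=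
  Ideal.span {x | ∃ a : latt v, a ≠ 0 ∧ x = AddMonoidAlgebra.single a 1}

/-- The bracket power `J^{[q]}`: the ideal generated by the `q`-th powers of
elements of `J`. -/
def bracket {S : Type*} [CommRing S] (J : Ideal S) (q : ℕ) : Ideal S :=
  Ideal.span ((fun x => x ^ q) '' (J : Set S))

/-- `ν_a^J(q) = max {r ∈ ℕ | a^r ⊄ J^{[q]}}`. -/
def nuF {S : Type*} [CommRing S] (a J : Ideal S) (q : ℕ) : ℕ :=
  sSup {r : ℕ | ¬ a ^ r ≤ bracket J q}


theorem toR_add (a b : Fin d → ℤ) : toR (a + b) = toR a + toR b := by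
  ext i; simp [toR]

theorem toR_nsmul (m : ℕ) (a : Fin d → ℤ) : toR (m • a) = (m : ℝ) • toR a := by
  ext i; simp [toR]

theorem toR_sum (A : Finset (Fin d → ℤ)) (m : (Fin d → ℤ) → ℕ) :
    toR (∑ a ∈ A, m a • a) = ∑ a ∈ A, (m a : ℝ) • toR a := by
  ext i; simp [toR, Finset.sum_apply]

theorem toR_inj : Function.Injective (toR : (Fin d → ℤ) → (Fin d → ℝ)) := by
  intro a b h
  ext i
  have := congrFun h i
  simpa [toR] using this

theorem dual_add {v : Fin n → Fin d → ℤ} {x y : Fin d → ℝ} (hx : x ∈ dualCone v)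
    (hy : y ∈ dualCone v) : x + y ∈ dualCone v := by
  intro z hz
  have h : pair (x + y) z = pair x z + pair y z := by
    simp [pair, add_mul, Finset.sum_add_distrib]
  rw [h]
  exact add_nonneg (hx z hz) (hy z hz)

theorem dual_smul {v : Fin n → Fin d → ℤ} {x : Fin d → ℝ} {c : ℝ} (hc : 0 ≤ c)
    (hx : x ∈ dualCone v) : c • x ∈ dualCone v := by
  intro z hz
  have h : pair (c • x) z = c * pair x z := by
    simp [pair, Finset.mul_sum, mul_assoc]
  rw [h]
  exact mul_nonneg hc (hx z hz)

theorem dual_zero {v : Fin n → Fin d → ℤ} : (0 : Fin d → ℝ) ∈ dualCone v := by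
  intro z hz
  simp [pair]

theorem dual_sum {v : Fin n → Fin d → ℤ} {ι : Type*} (s : Finset ι) (f : ι → Fin d → ℝ)
    (h : ∀ i ∈ s, f i ∈ dualCone v) : ∑ i ∈ s, f i ∈ dualCone v := by
  classical
  induction s using Finset.induction_on with
  | empty => simpa using dual_zero
  | insert a s ha ih =>
    rw [Finset.sum_insert ha]
    exact dual_add (h a (by simp)) (ih fun i hi => h i (by simp [hi]))

theorem mem_QSet {v : Fin n → Fin d → ℤ} {B : Finset (Fin d → ℤ)} {x : Fin d → ℝ} :
    x ∈ QSet v B ↔ ∃ b ∈ B, x - toR b ∈ dualCone v := by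
  simp only [QSet, Set.mem_iUnion, exists_prop, Set.mem_vadd_set, vadd_eq_add]
  constructor
  · rintro ⟨b, hb, y, hy, rfl⟩
    exact ⟨b, hb, by simpa using hy⟩
  · rintro ⟨b, hb, h⟩
    exact ⟨b, hb, _, h, by simp⟩

theorem QSet_add {v : Fin n → Fin d → ℤ} {B : Finset (Fin d → ℤ)} {x y : Fin d → ℝ}
    (hx : x ∈ QSet v B) (hy : y ∈ dualCone v) : x + y ∈ QSet v B := by
  rw [mem_QSet] at *
  obtain ⟨b, hb, h⟩ := hx
  refine ⟨b, hb, ?_⟩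
  have := dual_add h hy
  rwa [show x + y - toR b = x - toR b + y by abel]

theorem mem_latt {v : Fin n → Fin d → ℤ} {u : Fin d → ℤ} :
    u ∈ latt v ↔ toR u ∈ dualCone v := Iff.rfl

theorem single_mem_span {k : Type} [Field k] {v : Fin n → Fin d → ℤ} (P : latt v → Prop)
    (u : latt v) :
    (AddMonoidAlgebra.single u 1 : Toric k v) ∈
      Ideal.span {x : Toric k v | ∃ a : latt v, P a ∧ x = AddMonoidAlgebra.single a 1} ↔
      ∃ a, P a ∧ ∃ w, u = w + a := by
  have hs : {x : Toric k v | ∃ a : latt v, P a ∧ x = AddMonoidAlgebra.single a 1} =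
      AddMonoidAlgebra.of' k (latt v) '' {a | P a} := by
    ext x
    simp only [Set.mem_setOf_eq, Set.mem_image, AddMonoidAlgebra.of']
    exact ⟨fun ⟨a, h, e⟩ => ⟨a, h, e.symm⟩, fun ⟨a, h, e⟩ => ⟨a, h, e.symm⟩⟩
  rw [hs, AddMonoidAlgebra.mem_ideal_span_of'_image]
  have : (AddMonoidAlgebra.single u 1 : Toric k v).coeff.support = {u} := by
    simpa using Finsupp.support_single u (one_ne_zero : (1 : k) ≠ 0)
  rw [this]
  simp

theorem bracket_eq {p : ℕ} (hp : p.Prime) {k : Type} [Field k] [CharP k p]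
    (v : Fin n → Fin d → ℤ) (B : Finset (Fin d → ℤ)) (e : ℕ) :
    bracket (monIdeal k v B) (p ^ e) =
      Ideal.span {x : Toric k v | ∃ a : latt v,
        (∃ b : latt v, (b : Fin d → ℤ) ∈ B ∧ a = p ^ e • b) ∧
          x = AddMonoidAlgebra.single a 1} := by
  haveI : Fact p.Prime := ⟨hp⟩
  haveI : CharP (Toric k v) p :=
    charP_of_injective_algebraMap (algebraMap k (Toric k v)).injective p
  apply le_antisymm
  · rw [bracket, Ideal.span_le]
    rintro _ ⟨x, hx, rfl⟩
    simp only [SetLike.mem_coe] at hx ⊢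
    unfold monIdeal at hx
    induction hx using Submodule.span_induction with
    | mem x h =>
      obtain ⟨b, hb, rfl⟩ := h
      apply Ideal.subset_span
      exact ⟨_, ⟨b, hb, rfl⟩, by simp [AddMonoidAlgebra.single_pow]⟩
    | zero => rw [zero_pow (pow_ne_zero _ hp.ne_zero)]; exact Ideal.zero_mem _
    | add x y _ _ hx hy => rw [add_pow_char_pow]; exact Ideal.add_mem _ hx hy
    | smul r x _ hx => rw [smul_eq_mul, mul_pow]; exact Ideal.mul_mem_left _ _ hx
  · rw [Ideal.span_le]
    rintro _ ⟨_, ⟨b, hb, rfl⟩, rfl⟩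
    apply Ideal.subset_span
    refine ⟨AddMonoidAlgebra.single b 1, Ideal.subset_span ⟨b, hb, rfl⟩, ?_⟩
    simp [AddMonoidAlgebra.single_pow]

theorem mem_bracket {p : ℕ} (hp : p.Prime) {k : Type} [Field k] [CharP k p]
    (v : Fin n → Fin d → ℤ) (B : Finset (Fin d → ℤ))
    (hBl : ∀ b ∈ B, toR b ∈ dualCone v) (e : ℕ) (u : latt v) :
    (AddMonoidAlgebra.single u 1 : Toric k v) ∈ bracket (monIdeal k v B) (p ^ e) ↔
      ((p : ℝ) ^ e)⁻¹ • toR (u : Fin d → ℤ) ∈ QSet v B := by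
  have hq : (0 : ℝ) < (p : ℝ) ^ e := pow_pos (by exact_mod_cast hp.pos) _
  rw [bracket_eq hp, single_mem_span, mem_QSet]
  constructor
  · rintro ⟨_, ⟨b, hb, rfl⟩, w, rfl⟩
    refine ⟨b, hb, ?_⟩
    have hw := dual_smul (inv_nonneg.2 hq.le) (mem_latt.1 w.2)
    convert hw using 1
    simp only [AddSubmonoid.coe_add, AddSubmonoidClass.coe_nsmul, toR_add, toR_nsmul, smul_add]
    push_cast
    rw [smul_smul, inv_mul_cancel₀ hq.ne']
    simp
  · rintro ⟨b, hb, h⟩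
    refine ⟨p ^ e • ⟨b, mem_latt.2 (hBl b hb)⟩, ⟨_, hb, rfl⟩,
      ⟨(u : Fin d → ℤ) - p ^ e • b, ?_⟩, ?_⟩
    · rw [mem_latt]
      have := dual_smul hq.le h
      convert this using 1
      rw [smul_sub, smul_smul, mul_inv_cancel₀ hq.ne']
      ext i
      simp [toR]
    · ext i
      simp

theorem pow_le_span {k : Type} [Field k] (v : Fin n → Fin d → ℤ) (A : Finset (Fin d → ℤ))
    (r : ℕ) :
    monIdeal k v A ^ r ≤ Ideal.span {x : Toric k v | ∃ u : latt v,
        (∃ m : (Fin d → ℤ) → ℕ, ∑ a ∈ A, m a = r ∧ (u : Fin d → ℤ) = ∑ a ∈ A, m a • a) ∧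
          x = AddMonoidAlgebra.single u 1} := by
  classical
  induction r with
  | zero =>
    intro x _
    have h1 : (1 : Toric k v) ∈ Ideal.span {x : Toric k v | ∃ u : latt v,
        (∃ m : (Fin d → ℤ) → ℕ, ∑ a ∈ A, m a = 0 ∧ (u : Fin d → ℤ) = ∑ a ∈ A, m a • a) ∧
          x = AddMonoidAlgebra.single u 1} := by
      apply Ideal.subset_span
      exact ⟨0, ⟨fun _ => 0, by simp, by simp⟩, rfl⟩
    rw [(Ideal.eq_top_iff_one _).2 h1]
    trivial
  | succ r ih =>
    rw [pow_succ]
    refine (Ideal.mul_mono_left ih).trans ?_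
    rw [monIdeal, Ideal.span_mul_span', Ideal.span_le]
    rintro _ ⟨_, ⟨u, ⟨m, hm, hu⟩, rfl⟩, _, ⟨a, ha, rfl⟩, rfl⟩
    apply Ideal.subset_span
    refine ⟨u + a, ⟨fun b => m b + if b = a then 1 else 0, ?_, ?_⟩, ?_⟩
    · rw [Finset.sum_add_distrib, hm]
      simp [ha]
    · simp only [add_smul, Finset.sum_add_distrib, AddSubmonoid.coe_add, hu, ite_smul, one_smul,
        zero_smul, Finset.sum_ite_eq', ha, if_true]
    · simp [AddMonoidAlgebra.single_mul_single]

theorem single_mem_pow {k : Type} [Field k] (v : Fin n → Fin d → ℤ) (A : Finset (Fin d → ℤ))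
    (hAl : ∀ a ∈ A, toR a ∈ dualCone v) (m : (Fin d → ℤ) → ℕ) (S : Finset (Fin d → ℤ)) :
    S ⊆ A → ∀ u : latt v, (u : Fin d → ℤ) = ∑ a ∈ S, m a • a →
      (AddMonoidAlgebra.single u 1 : Toric k v) ∈ monIdeal k v A ^ (∑ a ∈ S, m a) := by
  classical
  induction S using Finset.induction_on with
  | empty =>
    intro _ u hu
    simp
  | insert a S ha ih =>
    intro hS u hu
    have haA : a ∈ A := hS (by simp)
    have hS' : S ⊆ A := fun x hx => hS (by simp [hx])
    have hw : ∑ a ∈ S, m a • a ∈ latt v :=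
      AddSubmonoid.sum_mem _ fun b hb =>
        AddSubmonoid.nsmul_mem _ (mem_latt.2 (hAl b (hS' hb))) _
    have h1 := ih hS' ⟨_, hw⟩ rfl
    have h2 : (AddMonoidAlgebra.single (⟨a, mem_latt.2 (hAl a haA)⟩ : latt v) 1 : Toric k v) ∈
        monIdeal k v A := Ideal.subset_span ⟨_, haA, rfl⟩
    have h3 := Ideal.mul_mem_mul (Ideal.pow_mem_pow h2 (m a)) h1
    rw [Finset.sum_insert ha, pow_add]
    convert h3 using 1
    rw [AddMonoidAlgebra.single_pow, AddMonoidAlgebra.single_mul_single]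
    congr 1
    · ext i
      simp [hu, Finset.sum_insert ha]
    · simp

theorem not_pow_le {p : ℕ} (hp : p.Prime) {k : Type} [Field k] [CharP k p]
    (v : Fin n → Fin d → ℤ) (A B : Finset (Fin d → ℤ))
    (hAl : ∀ a ∈ A, toR a ∈ dualCone v)
    (hBl : ∀ b ∈ B, toR b ∈ dualCone v) (e r : ℕ) :
    ¬ monIdeal k v A ^ r ≤ bracket (monIdeal k v B) (p ^ e) ↔
      ∃ m : (Fin d → ℤ) → ℕ, ∑ a ∈ A, m a = r ∧
        ((p : ℝ) ^ e)⁻¹ • ∑ a ∈ A, (m a : ℝ) • toR a ∉ QSet v B := by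
  constructor
  · intro h
    by_contra! hc
    apply h
    refine (pow_le_span v A r).trans ?_
    rw [Ideal.span_le]
    rintro _ ⟨u, ⟨m, hm, hu⟩, rfl⟩
    have := hc m hm
    rw [← toR_sum, ← hu] at this
    exact (mem_bracket hp v B hBl e u).2 this
  · rintro ⟨m, hm, h⟩ hle
    have hw : ∑ a ∈ A, m a • a ∈ latt v :=
      AddSubmonoid.sum_mem _ fun b hb =>
        AddSubmonoid.nsmul_mem _ (mem_latt.2 (hAl b hb)) _
    have h1 := single_mem_pow (k := k) v A hAl m A subset_rfl ⟨_, hw⟩ rfl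
    rw [hm] at h1
    have h2 := (mem_bracket hp v B hBl e _).1 (hle h1)
    rw [toR_sum] at h2
    exact h h2

theorem exists_N {k : Type} [Field k] (v : Fin n → Fin d → ℤ) (A B : Finset (Fin d → ℤ))
    (hAl : ∀ a ∈ A, toR a ∈ dualCone v)
    (hrad : monIdeal k v A ≤ (monIdeal k v B).radical) :
    ∃ N : ℕ, ∀ a ∈ A, (N : ℝ) • toR a ∈ QSet v B := by
  classical
  have h : ∀ a ∈ A, ∃ N : ℕ, (N : ℝ) • toR a ∈ QSet v B := by
    intro a ha
    have h2 : (AddMonoidAlgebra.single (⟨a, mem_latt.2 (hAl a ha)⟩ : latt v) 1 : Toric k v) ∈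
        monIdeal k v A := Ideal.subset_span ⟨_, ha, rfl⟩
    obtain ⟨N, hN⟩ := hrad h2
    refine ⟨N, ?_⟩
    rw [AddMonoidAlgebra.single_pow, one_pow, monIdeal, single_mem_span] at hN
    obtain ⟨b, hb, w, hw⟩ := hN
    rw [mem_QSet]
    refine ⟨b, hb, ?_⟩
    have h3 := congrArg (fun x : latt v => toR (x : Fin d → ℤ)) hw
    simp only [AddSubmonoid.coe_add, AddSubmonoidClass.coe_nsmul, toR_add, toR_nsmul] at h3
    rw [h3]
    simpa using mem_latt.1 w.2
  choose! f hf using h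
  refine ⟨∑ a ∈ A, f a, fun a ha => ?_⟩
  rw [← Finset.add_sum_erase A f ha]
  push_cast
  rw [add_smul]
  exact QSet_add (hf a ha) (dual_smul (Finset.sum_nonneg fun _ _ => Nat.cast_nonneg _) (hAl a ha))

theorem key_bound (v : Fin n → Fin d → ℤ) (A B : Finset (Fin d → ℤ))
    (hAl : ∀ a ∈ A, toR a ∈ dualCone v) (N : ℕ)
    (hN : ∀ a ∈ A, (N : ℝ) • toR a ∈ QSet v B) (t : (Fin d → ℤ) → ℝ) (ht : ∀ a ∈ A, 0 ≤ t a)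
    (w : Fin d → ℝ) (hw : w ∈ dualCone v) (h : ∑ a ∈ A, t a • toR a + w ∉ QSet v B) :
    ∑ a ∈ A, t a ≤ A.card * N := by
  classical
  by_contra hc
  apply h
  have : ∃ a ∈ A, (N : ℝ) < t a := by
    by_contra! h'
    exact hc (by simpa using Finset.sum_le_card_nsmul A t N h')
  obtain ⟨a, ha, hlt⟩ := this
  rw [← Finset.add_sum_erase A _ ha]
  have h1 : t a • toR a = (N : ℝ) • toR a + (t a - N) • toR a := by
    rw [← add_smul]; simp
  rw [h1]
  refine QSet_add (QSet_add (QSet_add (hN a ha) (dual_smul (by linarith) (hAl a ha))) ?_) hw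
  exact dual_sum _ _ fun b hb =>
    dual_smul (ht b (Finset.mem_of_mem_erase hb)) (hAl b (Finset.mem_of_mem_erase hb))

theorem mem_newton (v : Fin n → Fin d → ℤ) (A : Finset (Fin d → ℤ)) (l : ℝ) (hl : 0 < l)
    (u : Fin d → ℝ) :
    u ∈ l • newton v A ↔ ∃ t : (Fin d → ℤ) → ℝ, (∀ a ∈ A, 0 ≤ t a) ∧ ∑ a ∈ A, t a = l ∧
      ∃ w ∈ dualCone v, u = ∑ a ∈ A, t a • toR a + w := by
  classical
  constructor
  · rintro ⟨_, ⟨x, hx, w, hw, rfl⟩, rfl⟩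
    rw [← Finset.coe_image, Finset.mem_convexHull'] at hx
    obtain ⟨s, hs0, hs1, rfl⟩ := hx
    rw [Finset.sum_image (toR_inj.injOn)] at hs1
    refine ⟨fun a => l * s (toR a), fun a ha =>
      mul_nonneg hl.le (hs0 _ (Finset.mem_image_of_mem _ ha)), ?_, l • w, dual_smul hl.le hw, ?_⟩
    · rw [← Finset.mul_sum, hs1, mul_one]
    · simp only [smul_add, mul_smul, ← Finset.smul_sum]
      rw [Finset.sum_image (toR_inj.injOn)]
  · rintro ⟨t, ht0, ht1, w, hw, rfl⟩
    refine ⟨∑ a ∈ A, (l⁻¹ * t a) • toR a + l⁻¹ • w, ⟨_, ?_, _, dual_smul (inv_nonneg.2 hl.le) hw,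
      rfl⟩, ?_⟩
    · apply (convex_convexHull ℝ _).sum_mem
      · intro a ha
        exact mul_nonneg (inv_nonneg.2 hl.le) (ht0 a ha)
      · rw [← Finset.mul_sum, ht1, inv_mul_cancel₀ hl.ne']
      · intro a ha
        exact subset_convexHull ℝ _ ⟨a, ha, rfl⟩
    · simp only [smul_add, mul_smul, ← Finset.smul_sum]
      rw [smul_smul, smul_smul, mul_inv_cancel₀ hl.ne', one_smul, one_smul]

/-- the F-threshold `c^J(a)` of the monomial ideal `a` with
exponent set `A` with respect to the monomial ideal `J` with exponent set `B`
equals `sup_{u ∈ σ^∨ \ Q(B)} λ_A(u)`. -/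
theorem fthreshold_formula
    (d n p : ℕ) (hd : 1 ≤ d) (hp : p.Prime)
    (k : Type) [Field k] [CharP k p] [ExpChar k p] [PerfectRing k p]
    (v : Fin n → Fin d → ℤ)
    (hsc : StronglyConvex v) (hprim : ∀ j, IsPrimitive (v j))
    (A B : Finset (Fin d → ℤ))
    (hAne : A.Nonempty) (hBne : B.Nonempty)
    (hAl : ∀ a ∈ A, toR a ∈ dualCone v) (hBl : ∀ b ∈ B, toR b ∈ dualCone v)
    (ha0 : monIdeal k v A ≠ ⊥) (haP : monIdeal k v A ≠ ⊤)
    (hJ0 : monIdeal k v B ≠ ⊥) (hJP : monIdeal k v B ≠ ⊤)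
    (hrad : monIdeal k v A ≤ (monIdeal k v B).radical) :
    Filter.Tendsto
      (fun e : ℕ => (nuF (monIdeal k v A) (monIdeal k v B) (p ^ e) : ℝ) / (p ^ e : ℝ))
      Filter.atTop
      (nhds (sSup (lam v A '' (dualCone v \ QSet v B)))) := by
  classical
  obtain ⟨N, hN⟩ := exists_N v A B hAl hrad
  set S := sSup (lam v A '' (dualCone v \ QSet v B)) with hS
  have hl_bd : ∀ u ∉ QSet v B, ∀ l ∈ {l : ℝ | 0 < l ∧ u ∈ l • newton v A},
      l ≤ A.card * N := by
    rintro u hu l ⟨hl, h⟩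
    obtain ⟨t, ht0, rfl, w, hw, rfl⟩ := (mem_newton v A l hl u).1 h
    exact key_bound v A B hAl N hN t ht0 w hw hu
  have hlam_bd : BddAbove (lam v A '' (dualCone v \ QSet v B)) := by
    refine ⟨A.card * N, ?_⟩
    rintro _ ⟨u, ⟨_, hu⟩, rfl⟩
    exact Real.sSup_le (hl_bd u hu) (by positivity)
  have hS0 : 0 ≤ S := by
    apply Real.sSup_nonneg
    rintro _ ⟨u, _, rfl⟩
    exact Real.sSup_nonneg fun l hl => hl.1.le
  have hq : ∀ e : ℕ, (0 : ℝ) < (p : ℝ) ^ e := fun e => pow_pos (by exact_mod_cast hp.pos) _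
  -- upper bound for all elements of the set
  have hup : ∀ e r : ℕ, ¬ monIdeal k v A ^ r ≤ bracket (monIdeal k v B) (p ^ e) →
      (r : ℝ) / (p : ℝ) ^ e ≤ S := by
    intro e r hr
    rcases Nat.eq_zero_or_pos r with rfl | hr0
    · simpa using hS0
    obtain ⟨m, hm, hu⟩ := (not_pow_le hp v A B hAl hBl e r).1 hr
    set u := ((p : ℝ) ^ e)⁻¹ • ∑ a ∈ A, (m a : ℝ) • toR a with hudef
    have hud : u ∈ dualCone v := dual_smul (inv_nonneg.2 (hq e).le)
      (dual_sum _ _ fun a ha => dual_smul (Nat.cast_nonneg _) (hAl a ha))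
    have hpos : (0 : ℝ) < (r : ℝ) / (p : ℝ) ^ e := div_pos (by exact_mod_cast hr0) (hq e)
    have hmem : u ∈ ((r : ℝ) / (p : ℝ) ^ e) • newton v A := by
      rw [mem_newton v A _ hpos]
      refine ⟨fun a => ((p : ℝ) ^ e)⁻¹ * m a, fun a _ => by have := hq e; positivity, ?_, 0,
        dual_zero, ?_⟩
      · rw [← Finset.mul_sum, ← hm]
        push_cast
        rw [div_eq_inv_mul]
      · rw [hudef, add_zero, Finset.smul_sum]
        simp only [mul_smul]
    have h1 : (r : ℝ) / (p : ℝ) ^ e ≤ lam v A u := le_csSup ⟨_, hl_bd u hu⟩ ⟨hpos, hmem⟩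
    exact h1.trans (le_csSup hlam_bd ⟨u, ⟨hud, hu⟩, rfl⟩)
  have hbdd : ∀ e : ℕ, BddAbove {r : ℕ | ¬ monIdeal k v A ^ r ≤ bracket (monIdeal k v B) (p ^ e)} := by
    intro e
    refine ⟨⌈S * (p : ℝ) ^ e⌉₊, fun r hr => ?_⟩
    have := hup e r hr
    rw [div_le_iff₀ (hq e)] at this
    exact_mod_cast this.trans (Nat.le_ceil _)
  have hub : ∀ e : ℕ, (nuF (monIdeal k v A) (monIdeal k v B) (p ^ e) : ℝ) / (p ^ e : ℝ) ≤ S := by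
    intro e
    rcases Set.eq_empty_or_nonempty
      {r : ℕ | ¬ monIdeal k v A ^ r ≤ bracket (monIdeal k v B) (p ^ e)} with h | h
    · rw [nuF, h]
      simpa using hS0
    · exact hup e _ (Nat.sSup_mem h (hbdd e))
  have hlb : ∀ e : ℕ, S - A.card / (p : ℝ) ^ e ≤
      (nuF (monIdeal k v A) (monIdeal k v B) (p ^ e) : ℝ) / (p ^ e : ℝ) := by
    intro e
    have hqe := hq e
    rw [sub_le_iff_le_add, ← add_div]
    have hnn : (0 : ℝ) ≤ (nuF (monIdeal k v A) (monIdeal k v B) (p ^ e) + A.card : ℝ) /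
        (p : ℝ) ^ e := by positivity
    refine Real.sSup_le ?_ hnn
    rintro _ ⟨u, ⟨hud, hu⟩, rfl⟩
    refine Real.sSup_le ?_ hnn
    rintro l ⟨hl, h⟩
    obtain ⟨t, ht0, ht1, w, hw, rfl⟩ := (mem_newton v A l hl u).1 h
    have hfl : ∀ a ∈ A, (⌊(p : ℝ) ^ e * t a⌋₊ : ℝ) ≤ (p : ℝ) ^ e * t a := fun a ha =>
      Nat.floor_le (mul_nonneg hqe.le (ht0 a ha))
    have hmem : ¬ monIdeal k v A ^ (∑ a ∈ A, ⌊(p : ℝ) ^ e * t a⌋₊) ≤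
        bracket (monIdeal k v B) (p ^ e) := by
      rw [not_pow_le hp v A B hAl hBl]
      refine ⟨fun a => ⌊(p : ℝ) ^ e * t a⌋₊, rfl, fun hQ => hu ?_⟩
      refine QSet_add ?_ hw
      have hd : ∑ a ∈ A, (t a - ((p : ℝ) ^ e)⁻¹ * ⌊(p : ℝ) ^ e * t a⌋₊) • toR a ∈ dualCone v := by
        refine dual_sum _ _ fun a ha => dual_smul ?_ (hAl a ha)
        rw [sub_nonneg, inv_mul_le_iff₀ hqe]
        exact hfl a ha
      convert QSet_add hQ hd using 1
      rw [Finset.smul_sum, ← Finset.sum_add_distrib]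
      refine Finset.sum_congr rfl fun a _ => ?_
      rw [smul_smul, ← add_smul]
      simp
    have h1 : ∑ a ∈ A, ⌊(p : ℝ) ^ e * t a⌋₊ ≤ nuF (monIdeal k v A) (monIdeal k v B) (p ^ e) :=
      le_csSup (hbdd e) hmem
    have h2 : (∑ a ∈ A, (⌊(p : ℝ) ^ e * t a⌋₊ : ℝ)) ≤
        nuF (monIdeal k v A) (monIdeal k v B) (p ^ e) := by exact_mod_cast h1
    have h3 : ∑ a ∈ A, (p : ℝ) ^ e * t a ≤ ∑ a ∈ A, ((⌊(p : ℝ) ^ e * t a⌋₊ : ℝ) + 1) :=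
      Finset.sum_le_sum fun a _ => (Nat.lt_floor_add_one _).le
    rw [← Finset.mul_sum, ht1, Finset.sum_add_distrib] at h3
    simp only [Finset.sum_const, nsmul_eq_mul, mul_one] at h3
    rw [le_div_iff₀ hqe]
    linarith
  refine tendsto_of_tendsto_of_tendsto_of_le_of_le ?_ tendsto_const_nhds hlb hub
  have hlim : Filter.Tendsto (fun e : ℕ => (A.card : ℝ) / (p : ℝ) ^ e) Filter.atTop (nhds 0) :=
    tendsto_const_nhds.div_atTop
      (tendsto_pow_atTop_atTop_of_one_lt (by exact_mod_cast hp.one_lt))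
  simpa using tendsto_const_nhds.sub hlim

end Paper
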